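/- Let m ≥ 1 with gcd(m, 30) = 1 and let π = (ℤ/mℤ) × I*, where I* is the binary icosahedral group of order 120. Then dim_ℂ 𝒜_Θ^odd(ℂπ) = (74/3)m² + 19m + 64/3 and dim_ℂ 𝒜_Θ^odd(Ker ε) = (74/3)m² + (29/2)m + 101/6. In particular, for m = 1 (π = I*), dim_ℂ 𝒜_Θ^odd(ℂπ) = 65 and dim_ℂ 𝒜_Θ^odd(Ker ε) = 56. -/

import Mathlib

/-!
Statement 8: dimensions of `𝒜_Θ^odd(ℂπ)` and `𝒜_Θ^odd(Ker ε)` for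
`π = (ℤ/mℤ) × I*`, where `I*` is the binary icosahedral group of order 120,
realized as `SL(2, ℤ/5ℤ)`; in particular the values `65` and `56` for `π = I*` itself.

Identifying `(ℂπ)^{⊗3}` with functions `π³ → ℂ`, `dim 𝒜_Θ^odd(ℂπ)` (resp.
`dim 𝒜_Θ^odd(Ker ε)`) is the dimension of the space of functions `π³ → ℂ`
(resp. of such functions with vanishing marginal sums, cutting out `(Ker ε)^{⊗3}`)
invariant under permutations of the coordinates, the two-sided action
`(x,y,z) ↦ (gxh⁻¹,gyh⁻¹,gzh⁻¹)` and coordinatewise inversion.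
-/

open scoped BigOperators

/-- The dimension `dim_ℂ 𝒜_Θ^odd(ℂπ)`. -/
noncomputable def dimAThetaOddGroupAlgebra (G : Type*) [Group G] : ℕ :=
  Module.finrank ℂ ↥(Submodule.span ℂ
    { f : G × G × G → ℂ |
      (∀ x y z : G, f (y, x, z) = f (x, y, z)) ∧
      (∀ x y z : G, f (x, z, y) = f (x, y, z)) ∧
      (∀ g h x y z : G, f (g * x * h⁻¹, g * y * h⁻¹, g * z * h⁻¹) = f (x, y, z)) ∧
      (∀ x y z : G, f (x⁻¹, y⁻¹, z⁻¹) = f (x, y, z)) })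

/-- The dimension `dim_ℂ 𝒜_Θ^odd(Ker ε)`. -/
noncomputable def dimAThetaOddKerAug (G : Type*) [Group G] : ℕ :=
  Module.finrank ℂ ↥(Submodule.span ℂ
    { f : G × G × G → ℂ |
      (∀ x y z : G, f (y, x, z) = f (x, y, z)) ∧
      (∀ x y z : G, f (x, z, y) = f (x, y, z)) ∧
      (∀ g h x y z : G, f (g * x * h⁻¹, g * y * h⁻¹, g * z * h⁻¹) = f (x, y, z)) ∧
      (∀ x y z : G, f (x⁻¹, y⁻¹, z⁻¹) = f (x, y, z)) ∧
      (∀ y z : G, ∑ᶠ x : G, f (x, y, z) = 0) ∧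
      (∀ x z : G, ∑ᶠ y : G, f (x, y, z) = 0) ∧
      (∀ x y : G, ∑ᶠ z : G, f (x, y, z) = 0) })

/-- The binary icosahedral group `I*` of order 120, realized as `SL(2, ℤ/5ℤ)`. -/
abbrev binaryIcosahedralGroup : Type :=
  Matrix.SpecialLinearGroup (Fin 2) (ZMod 5)

section Burnside

/-- Burnside's lemma for functions: the dimension of the invariants of a permutation action. -/
theorem card_mul_finrank_invariants {Γ X : Type*} [Group Γ] [Fintype Γ] [Finite X]
    (ρ : Γ →* Equiv.Perm X) (S : Submodule ℂ (X → ℂ))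
    (hS : ∀ f, f ∈ S ↔ ∀ γ x, f (ρ γ x) = f x) :
    Fintype.card Γ * Module.finrank ℂ S = ∑ γ, Nat.card {x // ρ γ x = x} := by
  classical
  have := Fintype.ofFinite X
  let _ : MulAction Γ X := MulAction.compHom X ρ
  have hsmul : ∀ (γ : Γ) (x : X), γ • x = ρ γ x := fun _ _ => rfl
  let Q := MulAction.orbitRel.Quotient Γ X
  let φ : (Q → ℂ) →ₗ[ℂ] (X → ℂ) := LinearMap.funLeft ℂ ℂ (Quotient.mk'' : X → Q)
  have hφ : Function.Injective φ :=
    LinearMap.funLeft_injective_of_surjective ℂ ℂ _ Quotient.mk''_surjective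
  have hrange : LinearMap.range φ = S := by
    ext f
    rw [hS]
    constructor
    · rintro ⟨F, rfl⟩ γ x
      exact congrArg F (Quotient.sound' ⟨γ, rfl⟩)
    · intro hf
      refine ⟨fun q => Quotient.liftOn' q f ?_, rfl⟩
      rintro _ x ⟨γ, rfl⟩
      exact hf γ x
  have hdim : Module.finrank ℂ S = Fintype.card Q := by
    rw [← hrange, LinearMap.finrank_range_of_inj hφ, Module.finrank_fintype_fun_eq_card]
  rw [hdim, mul_comm, ← MulAction.sum_card_fixedBy_eq_card_orbits_mul_card_group]
  exact Finset.sum_congr rfl fun γ _ => (Nat.card_eq_fintype_card).symm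

end Burnside

section TwoSided

variable (G : Type*) [Group G]

/-- The homomorphism from `ℤˣ` sending `-1` to a given involution. -/
def involutionHom {M : Type*} [Group M] (a : M) (ha : a * a = 1) : ℤˣ →* M where
  toFun ε := if ε = 1 then 1 else a
  map_one' := if_pos rfl
  map_mul' ε δ := by
    rcases Int.units_eq_one_or ε with rfl | rfl <;> rcases Int.units_eq_one_or δ with rfl | rfl <;>
      simp [ha]

/-- The wreath product `G ≀ ℤ/2`, acting on `G` by two-sided translations and inversion. -/
abbrev TwoSided : Type _ :=
  (G × G) ⋊[involutionHom (M := MulAut (G × G)) MulEquiv.prodComm (by ext <;> rfl)] ℤˣ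

/-- The action of `G × G` on `G` by two-sided translations. -/
def translationHom : G × G →* Equiv.Perm G where
  toFun p :=
    { toFun x := p.1 * x * p.2⁻¹
      invFun x := p.1⁻¹ * x * p.2
      left_inv x := by simp [mul_assoc]
      right_inv x := by simp [mul_assoc] }
  map_one' := by ext; simp
  map_mul' p q := by ext; simp [mul_assoc]

/-- The action of the wreath product on `G`. -/
def twoSidedHom : TwoSided G →* Equiv.Perm G :=
  SemidirectProduct.lift (translationHom G)
    (involutionHom (Equiv.inv G) (by ext; simp)) fun ε => by
      rcases Int.units_eq_one_or ε with rfl | rfl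
      · ext; simp
      · ext; simp [involutionHom, translationHom, mul_assoc]

/-- The action of permutations, two-sided translations and inversion on `n`-tuples. -/
def tupleHom (n : ℕ) : Equiv.Perm (Fin n) × TwoSided G →* Equiv.Perm (Fin n → G) where
  toFun γ := Equiv.arrowCongr γ.1 (twoSidedHom G γ.2)
  map_one' := by ext; simp; rfl
  map_mul' γ δ := by ext; simp; rfl

variable {G} in
theorem tupleHom_one {n : ℕ} (σ : Equiv.Perm (Fin n)) (g h : G) (x : Fin n → G) (i : Fin n) :
    tupleHom G n (σ, ⟨(g, h), 1⟩) x i = g * x (σ.symm i) * h⁻¹ := by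
  change (translationHom G (g, h) * 1) (x (σ.symm i)) = _
  rfl

variable {G} in
theorem tupleHom_neg_one {n : ℕ} (σ : Equiv.Perm (Fin n)) (g h : G) (x : Fin n → G) (i : Fin n) :
    tupleHom G n (σ, ⟨(g, h), -1⟩) x i = g * (x (σ.symm i))⁻¹ * h⁻¹ := by
  change (translationHom G (g, h) * Equiv.inv G) (x (σ.symm i)) = _
  rfl

/-- Fixed points of the elements `(σ, g, h)`, up to the diagonal right translations. -/
noncomputable def directCount {n : ℕ} (σ : Equiv.Perm (Fin n)) : ℕ :=
  Nat.card {p : G × G × (Fin n → G) // ∀ i, p.1 * p.2.2 i = p.2.2 (σ i) * p.2.1}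

/-- Fixed points of the elements `(σ, g, h)` composed with inversion. -/
noncomputable def inverseCount {n : ℕ} (σ : Equiv.Perm (Fin n)) : ℕ :=
  Nat.card {p : G × G × (Fin n → G) // ∀ i, p.1 = p.2.2 (σ i) * p.2.1 * p.2.2 i}

theorem directCount_conj {n : ℕ} (σ τ : Equiv.Perm (Fin n)) :
    directCount G (τ * σ * τ⁻¹) = directCount G σ := by
  refine Nat.card_congr (Equiv.subtypeEquiv ((Equiv.refl G).prodCongr
    ((Equiv.refl G).prodCongr (Equiv.arrowCongr τ.symm (Equiv.refl G)))) fun p => ?_)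
  rw [← τ.forall_congr_right]
  simp

theorem inverseCount_conj {n : ℕ} (σ τ : Equiv.Perm (Fin n)) :
    inverseCount G (τ * σ * τ⁻¹) = inverseCount G σ := by
  refine Nat.card_congr (Equiv.subtypeEquiv ((Equiv.refl G).prodCongr
    ((Equiv.refl G).prodCongr (Equiv.arrowCongr τ.symm (Equiv.refl G)))) fun p => ?_)
  rw [← τ.forall_congr_right]
  simp

theorem sum_card_fixed_tupleHom [Fintype G] (n : ℕ) [Fintype (TwoSided G)] :
    ∑ γ, Nat.card {x // tupleHom G n γ x = x} =
      ∑ σ : Equiv.Perm (Fin n), (directCount G σ + inverseCount G σ) := by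
  classical
  have key (P : G → G → (Fin n → G) → Prop) :
      ∑ p : G × G, Nat.card {x // P p.1 p.2 x} =
        Nat.card {p : G × G × (Fin n → G) // P p.1 p.2.1 p.2.2} := by
    rw [← Nat.card_sigma]
    exact Nat.card_congr
      { toFun p := ⟨(p.1.1, p.1.2, p.2.1), p.2.2⟩
        invFun p := ⟨(p.1.1, p.1.2.1), ⟨p.1.2.2, p.2⟩⟩
        left_inv _ := rfl
        right_inv _ := rfl }
  rw [Fintype.sum_prod_type]
  refine Finset.sum_congr rfl fun σ _ => ?_
  rw [← SemidirectProduct.equivProd.symm.sum_comp, Fintype.sum_prod_type_right, UnitsInt.univ,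
    Finset.sum_pair (by decide)]
  simp only [SemidirectProduct.equivProd, Equiv.coe_fn_symm_mk, funext_iff]
  congr 1
  · refine (key fun g h x => ∀ i, tupleHom G n (σ, ⟨(g, h), 1⟩) x i = x i).trans
      (Nat.card_congr (Equiv.subtypeEquivRight fun p => ?_))
    rw [← σ.forall_congr_right]
    simp only [tupleHom_one, Equiv.symm_apply_apply, mul_inv_eq_iff_eq_mul]
  · refine (key fun g h x => ∀ i, tupleHom G n (σ, ⟨(g, h), -1⟩) x i = x i).trans
      (Nat.card_congr (Equiv.subtypeEquivRight fun p => ?_))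
    rw [← σ.forall_congr_right]
    simp only [tupleHom_neg_one, Equiv.symm_apply_apply, mul_inv_eq_iff_eq_mul]

theorem finrank_tuple_invariants [Fintype G] (n : ℕ) (S : Submodule ℂ ((Fin n → G) → ℂ))
    (hS : ∀ f, f ∈ S ↔ ∀ γ x, f (tupleHom G n γ x) = f x) :
    n.factorial * (2 * Fintype.card G ^ 2) * Module.finrank ℂ S =
      ∑ σ : Equiv.Perm (Fin n), (directCount G σ + inverseCount G σ) := by
  classical
  let _ : Fintype (TwoSided G) := Fintype.ofEquiv _ SemidirectProduct.equivProd.symm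
  rw [← sum_card_fixed_tupleHom, ← card_mul_finrank_invariants _ S hS, Fintype.card_prod,
    Fintype.card_perm, Fintype.card_congr SemidirectProduct.equivProd]
  simp [Fintype.card_prod]
  ring_nf
  simp

end TwoSided

section Counts

theorem Nat.card_subtype_congr {α β : Type*} {P : α → Prop} {Q : β → Prop} (f : α → β) (g : β → α)
    (hf : ∀ a, P a → Q (f a)) (hg : ∀ b, Q b → P (g b)) (hgf : ∀ a, P a → g (f a) = a)
    (hfg : ∀ b, Q b → f (g b) = b) : Nat.card {a // P a} = Nat.card {b // Q b} :=
  Nat.card_congr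
    { toFun a := ⟨f a, hf a a.2⟩
      invFun b := ⟨g b, hg b b.2⟩
      left_inv a := Subtype.ext (hgf a a.2)
      right_inv b := Subtype.ext (hfg b b.2) }

theorem Nat.card_subtype_of_equiv_prod {α β γ : Type*} {P : α → Prop} {Q : β → Prop}
    {R : γ → Prop} (e : γ ≃ α × β) (h : ∀ a b, R (e.symm (a, b)) ↔ P a ∧ Q b) :
    Nat.card {c // R c} = Nat.card {a // P a} * Nat.card {b // Q b} := by
  rw [← Nat.card_prod]
  refine Nat.card_congr ((Equiv.subtypeEquiv e fun c => ?_).trans Equiv.subtypeProdEquivProd)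
  rw [← h, Prod.mk.eta, e.symm_apply_apply]

variable (G : Type*) [Group G]

/-- The number of triples whose first entry commutes with the other two. -/
noncomputable def commutingTriples : ℕ :=
  Nat.card {p : G × G × G // p.1 * p.2.1 = p.2.1 * p.1 ∧ p.1 * p.2.2 = p.2.2 * p.1}

/-- The number of pairs in which the square of the first entry commutes with the second. -/
noncomputable def squareCommuting : ℕ :=
  Nat.card {p : G × G // p.1 * p.1 * p.2 = p.2 * (p.1 * p.1)}

/-- The number of pairs with equal cubes. -/
noncomputable def equalCubes : ℕ :=
  Nat.card {p : G × G // p.1 * p.1 * p.1 = p.2 * p.2 * p.2}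

/-- The number of triples whose first entry `k` satisfies `c * k * c = k` for the other two. -/
noncomputable def reversingTriples : ℕ :=
  Nat.card {p : G × G × G // p.2.1 * p.1 * p.2.1 = p.1 ∧ p.2.2 * p.1 * p.2.2 = p.1}

/-- The number of pairs `(k, c)` with `c * k ^ 2 * c = k * c * k`. -/
noncomputable def braidPairs : ℕ :=
  Nat.card {p : G × G // p.2 * (p.1 * p.1) * p.2 = p.1 * p.2 * p.1}

/-- The number of commuting pairs. -/
noncomputable def commutingPairs : ℕ :=
  Nat.card {p : G × G // p.1 * p.2 = p.2 * p.1}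

/-- The number of pairs with equal squares. -/
noncomputable def equalSquares : ℕ :=
  Nat.card {p : G × G // p.1 * p.1 = p.2 * p.2}

/-- The number of pairs `(k, c)` with `c * k * c = k`. -/
noncomputable def reversingPairs : ℕ :=
  Nat.card {p : G × G // p.2 * p.1 * p.2 = p.1}

variable {G}

/-- A tuple normalized by a right translation to have first entry `1`. -/
def directNormalization (n : ℕ) : G × G × (Fin (n + 1) → G) ≃ G × (G × G × (Fin n → G)) where
  toFun p := (p.2.2 0, p.1, p.2.2 0 * p.2.1 * (p.2.2 0)⁻¹, fun i => p.2.2 i.succ * (p.2.2 0)⁻¹)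
  invFun q := (q.2.1, q.1⁻¹ * q.2.2.1 * q.1,
    fun i => (Fin.cons 1 q.2.2.2 : Fin (n + 1) → G) i * q.1)
  left_inv p := by
    refine Prod.ext rfl (Prod.ext (by simp [mul_assoc]) (funext fun i => ?_))
    cases i using Fin.cases <;> simp
  right_inv q := by
    refine Prod.ext (by simp) (Prod.ext rfl (Prod.ext (by simp [mul_assoc]) (funext fun i => ?_)))
    simp

/-- The normalization adapted to the fixed points of inversion. -/
def inverseNormalization (n : ℕ) : G × G × (Fin (n + 1) → G) ≃ G × (G × G × (Fin n → G)) where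
  toFun p := (p.2.2 0, p.1 * (p.2.2 0)⁻¹, p.2.2 0 * p.2.1, fun i => p.2.2 i.succ * (p.2.2 0)⁻¹)
  invFun q := (q.2.1 * q.1, q.1⁻¹ * q.2.2.1,
    fun i => (Fin.cons 1 q.2.2.2 : Fin (n + 1) → G) i * q.1)
  left_inv p := by
    refine Prod.ext (by simp) (Prod.ext (by simp) (funext fun i => ?_))
    cases i using Fin.cases <;> simp
  right_inv q := by
    refine Prod.ext (by simp) (Prod.ext (by simp) (Prod.ext (by simp) (funext fun i => ?_)))
    simp

theorem directCount_eq_card_mul {n : ℕ} (σ : Equiv.Perm (Fin (n + 1))) :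
    directCount G σ = Nat.card G * Nat.card {q : G × G × (Fin n → G) // ∀ i,
      q.1 * (Fin.cons 1 q.2.2 : Fin (n + 1) → G) i =
        (Fin.cons 1 q.2.2 : Fin (n + 1) → G) (σ i) * q.2.1} := by
  rw [← Nat.card_congr (Equiv.subtypeUnivEquiv fun _ : G => trivial)]
  refine Nat.card_subtype_of_equiv_prod (directNormalization n) fun y q => ?_
  simp [directNormalization, ← mul_assoc]

theorem inverseCount_eq_card_mul {n : ℕ} (σ : Equiv.Perm (Fin (n + 1))) :
    inverseCount G σ = Nat.card G * Nat.card {q : G × G × (Fin n → G) // ∀ i,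
      q.1 = (Fin.cons 1 q.2.2 : Fin (n + 1) → G) (σ i) * q.2.1 *
        (Fin.cons 1 q.2.2 : Fin (n + 1) → G) i} := by
  rw [← Nat.card_congr (Equiv.subtypeUnivEquiv fun _ : G => trivial)]
  refine Nat.card_subtype_of_equiv_prod (inverseNormalization n) fun y q => ?_
  simp [inverseNormalization, ← mul_assoc]

theorem directCount_three (σ : Equiv.Perm (Fin 3)) {i j k : Fin 3} (hi : σ 0 = i) (hj : σ 1 = j)
    (hk : σ 2 = k) :
    directCount G σ = Nat.card G * Nat.card {q : G × G × G × G //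
      q.1 = ![1, q.2.2.1, q.2.2.2] i * q.2.1 ∧
        q.1 * q.2.2.1 = ![1, q.2.2.1, q.2.2.2] j * q.2.1 ∧
        q.1 * q.2.2.2 = ![1, q.2.2.1, q.2.2.2] k * q.2.1} := by
  rw [directCount_eq_card_mul]
  congr 1
  refine (Nat.card_congr (Equiv.subtypeEquiv ((Equiv.refl G).prodCongr
    ((Equiv.refl G).prodCongr (finTwoArrowEquiv G).symm)) fun q => ?_)).symm
  rw [Fin.forall_fin_succ, Fin.forall_fin_two]
  simp only [Fin.succ_zero_eq_one, Fin.succ_one_eq_two, hi, hj, hk]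
  change _ ↔ q.1 * 1 = _ ∧ _
  rw [mul_one]
  rfl

theorem inverseCount_three (σ : Equiv.Perm (Fin 3)) {i j k : Fin 3} (hi : σ 0 = i) (hj : σ 1 = j)
    (hk : σ 2 = k) :
    inverseCount G σ = Nat.card G * Nat.card {q : G × G × G × G //
      q.1 = ![1, q.2.2.1, q.2.2.2] i * q.2.1 ∧
        q.1 = ![1, q.2.2.1, q.2.2.2] j * q.2.1 * q.2.2.1 ∧
        q.1 = ![1, q.2.2.1, q.2.2.2] k * q.2.1 * q.2.2.2} := by
  rw [inverseCount_eq_card_mul]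
  congr 1
  refine (Nat.card_congr (Equiv.subtypeEquiv ((Equiv.refl G).prodCongr
    ((Equiv.refl G).prodCongr (finTwoArrowEquiv G).symm)) fun q => ?_)).symm
  rw [Fin.forall_fin_succ, Fin.forall_fin_two]
  simp only [Fin.succ_zero_eq_one, Fin.succ_one_eq_two, hi, hj, hk]
  change _ ↔ q.1 = _ * 1 ∧ _
  rw [mul_one]
  rfl

theorem directCount_two (σ : Equiv.Perm (Fin 2)) {i j : Fin 2} (hi : σ 0 = i) (hj : σ 1 = j) :
    directCount G σ = Nat.card G * Nat.card {q : G × G × G //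
      q.1 = ![1, q.2.2] i * q.2.1 ∧ q.1 * q.2.2 = ![1, q.2.2] j * q.2.1} := by
  rw [directCount_eq_card_mul]
  congr 1
  let e : G ≃ (Fin 1 → G) := ⟨fun c => ![c], fun q => q 0, fun _ => rfl, fun q => funext fun i => by
    rw [Subsingleton.elim i 0]; rfl⟩
  refine (Nat.card_congr (Equiv.subtypeEquiv ((Equiv.refl G).prodCongr
    ((Equiv.refl G).prodCongr e)) fun q => ?_)).symm
  rw [Fin.forall_fin_two]
  simp only [hi, hj]
  change _ ↔ q.1 * 1 = _ ∧ _
  rw [mul_one]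
  rfl

theorem inverseCount_two (σ : Equiv.Perm (Fin 2)) {i j : Fin 2} (hi : σ 0 = i) (hj : σ 1 = j) :
    inverseCount G σ = Nat.card G * Nat.card {q : G × G × G //
      q.1 = ![1, q.2.2] i * q.2.1 ∧ q.1 = ![1, q.2.2] j * q.2.1 * q.2.2} := by
  rw [inverseCount_eq_card_mul]
  congr 1
  let e : G ≃ (Fin 1 → G) := ⟨fun c => ![c], fun q => q 0, fun _ => rfl, fun q => funext fun i => by
    rw [Subsingleton.elim i 0]; rfl⟩
  refine (Nat.card_congr (Equiv.subtypeEquiv ((Equiv.refl G).prodCongr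
    ((Equiv.refl G).prodCongr e)) fun q => ?_)).symm
  rw [Fin.forall_fin_two]
  simp only [hi, hj]
  change _ ↔ q.1 = _ * 1 ∧ _
  rw [mul_one]
  rfl

theorem directCount_three_one :
    directCount G (1 : Equiv.Perm (Fin 3)) = Nat.card G * commutingTriples G := by
  rw [directCount_three 1 rfl rfl rfl]
  congr 1
  refine Nat.card_subtype_congr (fun q => (q.1, q.2.2.1, q.2.2.2))
    (fun p => (p.1, p.1, p.2.1, p.2.2)) ?_ ?_ ?_ ?_ <;> simp
  · rintro g w c d rfl h1 h2
    exact ⟨h1, h2⟩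
  · rintro g w c d rfl _ _
    rfl

theorem directCount_three_swap :
    directCount G (Equiv.swap (1 : Fin 3) 2) = Nat.card G * squareCommuting G := by
  rw [directCount_three (i := 0) (j := 2) (k := 1) _ (by decide) (by decide) (by decide)]
  congr 1
  refine Nat.card_subtype_congr (fun q => (q.1, q.2.2.1))
    (fun p => (p.1, p.1, p.2, p.1 * p.2 * p.1⁻¹)) ?_ ?_ ?_ ?_ <;> simp
  · rintro g w c d rfl h1 h2
    rw [mul_assoc, h1, ← mul_assoc, h2, mul_assoc]
  · intro g c h
    rw [← mul_assoc, ← mul_assoc, h, ← mul_assoc, mul_inv_cancel_right]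
  · rintro g w c d rfl h1 h2
    exact ⟨rfl, mul_inv_eq_of_eq_mul h1⟩

theorem directCount_three_cycle :
    directCount G (finRotate 3) = Nat.card G * equalCubes G := by
  rw [directCount_three (i := 1) (j := 2) (k := 0) _ (by decide) (by decide) (by decide)]
  congr 1
  refine Nat.card_subtype_congr (fun q => (q.1, q.2.1))
    (fun p => (p.1, p.2, p.1 * p.2⁻¹, p.1⁻¹ * p.2)) ?_ ?_ ?_ ?_ <;> simp
  · rintro g w c d rfl h1 h2
    calc c * w * (c * w) * (c * w) = c * w * (c * w * c) * w := by simp only [mul_assoc]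
      _ = w * w * w := by rw [h1, ← mul_assoc, h2]
  · intro g w h
    rw [← mul_assoc, mul_inv_eq_iff_eq_mul, mul_assoc, mul_assoc, eq_inv_mul_iff_mul_eq]
    simpa only [mul_assoc] using h
  · intro g w c d h1 h2 h3
    exact ⟨by rw [h1, mul_inv_cancel_right], by rw [inv_mul_eq_iff_eq_mul, h3]⟩

theorem inverseCount_three_one :
    inverseCount G (1 : Equiv.Perm (Fin 3)) = Nat.card G * reversingTriples G := by
  rw [inverseCount_three 1 rfl rfl rfl]
  congr 1
  refine Nat.card_subtype_congr (fun q => (q.1, q.2.2.1, q.2.2.2))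
    (fun p => (p.1, p.1, p.2.1, p.2.2)) ?_ ?_ ?_ ?_ <;> simp
  · rintro g w c d rfl h1 h2
    exact ⟨h1.symm, h2.symm⟩
  · intro g c d h1 h2
    exact ⟨h1.symm, h2.symm⟩
  · rintro g w c d rfl _ _
    rfl

theorem inverseCount_three_swap :
    inverseCount G (Equiv.swap (1 : Fin 3) 2) = Nat.card G * squareCommuting G := by
  rw [inverseCount_three (i := 0) (j := 2) (k := 1) _ (by decide) (by decide) (by decide)]
  congr 1
  refine Nat.card_subtype_congr (fun q => (q.1, q.2.2.1))
    (fun p => (p.1, p.1, p.2, p.1 * p.2⁻¹ * p.1⁻¹)) ?_ ?_ ?_ ?_ <;> simp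
  · rintro g w c d rfl h1 h2
    calc g * g * c = c * g * d * g * c := by rw [← h2]
      _ = c * (g * (d * g * c)) := by simp only [mul_assoc]
      _ = c * (g * g) := by rw [← h1]
  · intro g c h
    rw [← mul_assoc, ← mul_assoc, eq_mul_inv_iff_mul_eq, eq_mul_inv_iff_mul_eq, h, mul_assoc]
  · rintro g w c d rfl h1 h2
    exact ⟨rfl, by rw [mul_inv_eq_iff_eq_mul, mul_inv_eq_iff_eq_mul, ← h1]⟩

theorem inverseCount_three_cycle :
    inverseCount G (finRotate 3) = Nat.card G * braidPairs G := by
  rw [inverseCount_three (i := 1) (j := 2) (k := 0) _ (by decide) (by decide) (by decide)]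
  congr 1
  refine Nat.card_subtype_congr (fun q => (q.2.1, q.2.2.1))
    (fun p => (p.2 * p.1, p.1, p.2, p.1⁻¹ * p.2 * p.1)) ?_ ?_ ?_ ?_ <;> simp
  · rintro g w c d rfl h1 h2
    calc c * (w * w) * c = c * w * w * c := by simp only [mul_assoc]
      _ = w * (d * w * c) := by rw [h2]; simp only [mul_assoc]
      _ = w * c * w := by rw [← h1, mul_assoc]
  · intro g c h
    refine ⟨?_, by simp [← mul_assoc]⟩
    simp only [mul_assoc] at h ⊢
    rw [eq_inv_mul_iff_mul_eq, h]
  · rintro g w c d rfl h1 h2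
    exact ⟨rfl, by rw [mul_assoc, h2, inv_mul_cancel_left]⟩

theorem directCount_two_one :
    directCount G (1 : Equiv.Perm (Fin 2)) = Nat.card G * commutingPairs G := by
  rw [directCount_two 1 rfl rfl]
  congr 1
  refine Nat.card_subtype_congr (fun q => (q.1, q.2.2)) (fun p => (p.1, p.1, p.2)) ?_ ?_ ?_ ?_ <;>
    simp
  · rintro g w c rfl h
    exact h
  · rintro g w c rfl _
    rfl

theorem directCount_two_swap :
    directCount G (Equiv.swap (0 : Fin 2) 1) = Nat.card G * equalSquares G := by
  rw [directCount_two (i := 1) (j := 0) _ (by decide) (by decide)]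
  congr 1
  refine Nat.card_subtype_congr (fun q => (q.1, q.2.1)) (fun p => (p.1, p.2, p.1 * p.2⁻¹))
    ?_ ?_ ?_ ?_ <;> simp
  · rintro g w c rfl h
    rw [← mul_assoc, h]
  · intro g w h
    rw [← mul_assoc, h, mul_inv_cancel_right]
  · rintro g w c rfl _
    simp

theorem inverseCount_two_one :
    inverseCount G (1 : Equiv.Perm (Fin 2)) = Nat.card G * reversingPairs G := by
  rw [inverseCount_two 1 rfl rfl]
  congr 1
  refine Nat.card_subtype_congr (fun q => (q.1, q.2.2)) (fun p => (p.1, p.1, p.2)) ?_ ?_ ?_ ?_ <;>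
    simp
  · rintro g w c rfl h
    exact h.symm
  · intro g c h
    exact h.symm
  · rintro g w c rfl _
    rfl

theorem inverseCount_two_swap :
    inverseCount G (Equiv.swap (0 : Fin 2) 1) = Nat.card G * commutingPairs G := by
  rw [inverseCount_two (i := 1) (j := 0) _ (by decide) (by decide)]
  congr 1
  refine Nat.card_subtype_congr (fun q => (q.2.1, q.2.2)) (fun p => (p.2 * p.1, p.1, p.2))
    ?_ ?_ ?_ ?_ <;> simp
  · rintro g w c rfl h
    exact h.symm
  · intro g c h
    exact h.symm
  · rintro g w c rfl _
    rfl

end Counts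

section Dimension

theorem sum_perm_fin_three (f : Equiv.Perm (Fin 3) → ℕ) (hf : ∀ σ τ, f (τ * σ * τ⁻¹) = f σ) :
    ∑ σ, f σ = f 1 + 3 * f (Equiv.swap 1 2) + 2 * f (finRotate 3) := by
  have huniv : (Finset.univ : Finset (Equiv.Perm (Fin 3))) = {1, Equiv.swap 1 2,
      finRotate 3 * Equiv.swap 1 2 * (finRotate 3)⁻¹,
      (finRotate 3)⁻¹ * Equiv.swap 1 2 * (finRotate 3)⁻¹⁻¹, finRotate 3,
      Equiv.swap 1 2 * finRotate 3 * (Equiv.swap 1 2)⁻¹} := by decide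
  rw [huniv]
  repeat rw [Finset.sum_insert (by decide)]
  rw [Finset.sum_singleton, hf, hf, hf]
  ring

theorem sum_perm_fin_two (f : Equiv.Perm (Fin 2) → ℕ) :
    ∑ σ, f σ = f 1 + f (Equiv.swap 0 1) := by
  rw [show (Finset.univ : Finset (Equiv.Perm (Fin 2))) = {1, Equiv.swap 0 1} by decide,
    Finset.sum_pair (by decide)]

variable (G : Type*) [Group G]

/-- The invariant functions on `G ^ 3`, dual to the coinvariants of `Sym³ ℂG`. -/
def thetaInvariants : Submodule ℂ (G × G × G → ℂ) where
  carrier := { f |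
      (∀ x y z : G, f (y, x, z) = f (x, y, z)) ∧
      (∀ x y z : G, f (x, z, y) = f (x, y, z)) ∧
      (∀ g h x y z : G, f (g * x * h⁻¹, g * y * h⁻¹, g * z * h⁻¹) = f (x, y, z)) ∧
      (∀ x y z : G, f (x⁻¹, y⁻¹, z⁻¹) = f (x, y, z)) }
  zero_mem' := by simp
  add_mem' := by
    rintro a b ⟨h1, h2, h3, h4⟩ ⟨k1, k2, k3, k4⟩
    refine ⟨?_, ?_, ?_, ?_⟩ <;> intros <;> simp [*]
  smul_mem' := by
    rintro c a ⟨h1, h2, h3, h4⟩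
    refine ⟨?_, ?_, ?_, ?_⟩ <;> intros <;> simp [*]

/-- The invariant functions on `G ^ 2`. -/
def pairInvariants : Submodule ℂ (G × G → ℂ) where
  carrier := { f |
      (∀ x y : G, f (y, x) = f (x, y)) ∧
      (∀ g h x y : G, f (g * x * h⁻¹, g * y * h⁻¹) = f (x, y)) ∧
      (∀ x y : G, f (x⁻¹, y⁻¹) = f (x, y)) }
  zero_mem' := by simp
  add_mem' := by
    rintro a b ⟨h1, h2, h3⟩ ⟨k1, k2, k3⟩
    refine ⟨?_, ?_, ?_⟩ <;> intros <;> simp [*]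
  smul_mem' := by
    rintro c a ⟨h1, h2, h3⟩
    refine ⟨?_, ?_, ?_⟩ <;> intros <;> simp [*]

theorem dimAThetaOddGroupAlgebra_eq_finrank :
    dimAThetaOddGroupAlgebra G = Module.finrank ℂ (thetaInvariants G) := by
  rw [← Submodule.span_eq (thetaInvariants G)]
  rfl

variable {G}

theorem thetaInvariants_apply_perm {f : G × G × G → ℂ} (hf : f ∈ thetaInvariants G)
    (σ : Equiv.Perm (Fin 3)) (x : Fin 3 → G) :
    f (x (σ 0), x (σ 1), x (σ 2)) = f (x 0, x 1, x 2) := by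
  obtain ⟨h1, h2, -, -⟩ := hf
  have hσ : ∀ σ : Equiv.Perm (Fin 3), (σ 0 = 0 ∧ σ 1 = 1 ∧ σ 2 = 2) ∨
      (σ 0 = 0 ∧ σ 1 = 2 ∧ σ 2 = 1) ∨ (σ 0 = 1 ∧ σ 1 = 0 ∧ σ 2 = 2) ∨
      (σ 0 = 1 ∧ σ 1 = 2 ∧ σ 2 = 0) ∨ (σ 0 = 2 ∧ σ 1 = 0 ∧ σ 2 = 1) ∨
      (σ 0 = 2 ∧ σ 1 = 1 ∧ σ 2 = 0) := by decide
  rcases hσ σ with h | h | h | h | h | h <;> obtain ⟨a, b, c⟩ := h <;> rw [a, b, c]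
  · rw [h2]
  · rw [h1]
  · rw [h2, h1]
  · rw [h1, h2]
  · rw [h1, h2, h1]

theorem finrank_thetaInvariants [Fintype G] :
    12 * Fintype.card G * Module.finrank ℂ (thetaInvariants G) =
      commutingTriples G + 6 * squareCommuting G + 2 * equalCubes G + reversingTriples G +
        2 * braidPairs G := by
  let e : (Fin 3 → G) ≃ G × G × G :=
    { toFun x := (x 0, x 1, x 2)
      invFun p := ![p.1, p.2.1, p.2.2]
      left_inv x := by ext i; fin_cases i <;> rfl
      right_inv p := rfl }
  let E : (G × G × G → ℂ) ≃ₗ[ℂ] ((Fin 3 → G) → ℂ) := LinearEquiv.funCongrLeft ℂ ℂ e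
  have key := finrank_tuple_invariants G 3 ((thetaInvariants G).map E.toLinearMap) (by
    intro f
    obtain ⟨F, rfl⟩ := E.surjective f
    have hE : E F ∈ (thetaInvariants G).map E.toLinearMap ↔ F ∈ thetaInvariants G := by
      simp
    have hEF : ∀ x, E F x = F (x 0, x 1, x 2) := fun _ => rfl
    rw [hE]
    constructor
    · rintro hF ⟨σ, ⟨g, h⟩, ε⟩ x
      obtain ⟨-, -, h3, h4⟩ := id hF
      rcases Int.units_eq_one_or ε with rfl | rfl
      · rw [hEF, tupleHom_one, tupleHom_one, tupleHom_one, h3, hEF]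
        exact thetaInvariants_apply_perm hF σ⁻¹ x
      · rw [hEF, tupleHom_neg_one, tupleHom_neg_one, tupleHom_neg_one, h3, h4, hEF]
        exact thetaInvariants_apply_perm hF σ⁻¹ x
    · intro hF
      simp only [hEF] at hF
      refine ⟨fun x y z => ?_, fun x y z => ?_, fun g h x y z => ?_, fun x y z => ?_⟩
      · have := hF (Equiv.swap 0 1, ⟨(1, 1), 1⟩) ![x, y, z]
        simp only [tupleHom_one] at this
        simpa [Equiv.swap_apply_of_ne_of_ne] using this
      · have := hF (Equiv.swap 1 2, ⟨(1, 1), 1⟩) ![x, y, z]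
        simp only [tupleHom_one] at this
        simpa [Equiv.swap_apply_of_ne_of_ne] using this
      · have := hF (1, ⟨(g, h), 1⟩) ![x, y, z]
        simp only [tupleHom_one] at this
        exact this
      · have := hF (1, ⟨(1, 1), -1⟩) ![x, y, z]
        simp only [tupleHom_neg_one, one_mul, inv_one, mul_one] at this
        exact this)
  rw [sum_perm_fin_three _ fun σ τ => by rw [directCount_conj, inverseCount_conj],
    LinearEquiv.finrank_map_eq, directCount_three_one, directCount_three_swap,
    directCount_three_cycle, inverseCount_three_one, inverseCount_three_swap,
    inverseCount_three_cycle, Nat.card_eq_fintype_card] at key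
  refine Nat.eq_of_mul_eq_mul_left (Fintype.card_pos (α := G)) ?_
  rw [show Nat.factorial 3 = 6 from rfl] at key
  linear_combination key

theorem finrank_pairInvariants [Fintype G] :
    4 * Fintype.card G * Module.finrank ℂ (pairInvariants G) =
      2 * commutingPairs G + equalSquares G + reversingPairs G := by
  let e : (Fin 2 → G) ≃ G × G := finTwoArrowEquiv G
  let E : (G × G → ℂ) ≃ₗ[ℂ] ((Fin 2 → G) → ℂ) := LinearEquiv.funCongrLeft ℂ ℂ e
  have key := finrank_tuple_invariants G 2 ((pairInvariants G).map E.toLinearMap) (by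
    intro f
    obtain ⟨F, rfl⟩ := E.surjective f
    have hE : E F ∈ (pairInvariants G).map E.toLinearMap ↔ F ∈ pairInvariants G := by
      simp
    have hEF : ∀ x, E F x = F (x 0, x 1) := fun _ => rfl
    rw [hE]
    constructor
    · rintro ⟨h1, h3, h4⟩ ⟨σ, ⟨g, h⟩, ε⟩ x
      have hσ : ∀ σ : Equiv.Perm (Fin 2), (σ.symm 0 = 0 ∧ σ.symm 1 = 1) ∨
        (σ.symm 0 = 1 ∧ σ.symm 1 = 0) := by decide
      have hperm : F (x (σ.symm 0), x (σ.symm 1)) = F (x 0, x 1) := by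
        rcases hσ σ with h | h <;> rw [h.1, h.2]
        rw [h1]
      rcases Int.units_eq_one_or ε with rfl | rfl
      · rw [hEF, tupleHom_one, tupleHom_one, h3, hEF, hperm]
      · rw [hEF, tupleHom_neg_one, tupleHom_neg_one, h3, h4, hEF, hperm]
    · intro hF
      simp only [hEF] at hF
      refine ⟨fun x y => ?_, fun g h x y => ?_, fun x y => ?_⟩
      · have := hF (Equiv.swap 0 1, ⟨(1, 1), 1⟩) ![x, y]
        simp only [tupleHom_one] at this
        simpa using this
      · have := hF (1, ⟨(g, h), 1⟩) ![x, y]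
        simp only [tupleHom_one] at this
        exact this
      · have := hF (1, ⟨(1, 1), -1⟩) ![x, y]
        simp only [tupleHom_neg_one, one_mul, inv_one, mul_one] at this
        exact this)
  rw [sum_perm_fin_two, LinearEquiv.finrank_map_eq, directCount_two_one, directCount_two_swap,
    inverseCount_two_one, inverseCount_two_swap, Nat.card_eq_fintype_card] at key
  refine Nat.eq_of_mul_eq_mul_left (Fintype.card_pos (α := G)) ?_
  rw [show Nat.factorial 2 = 2 from rfl] at key
  linear_combination key

variable (G) in
/-- Summation over the first coordinate. -/
def marginal [Fintype G] : thetaInvariants G →ₗ[ℂ] pairInvariants G where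
  toFun f := ⟨fun p => ∑ x, f.1 (x, p), by
    obtain ⟨f, h1, h2, h3, h4⟩ := f
    refine ⟨fun y z => ?_, fun g h y z => ?_, fun y z => ?_⟩
    · exact Finset.sum_congr rfl fun x _ => h2 x y z
    · refine ((Equiv.sum_comp (translationHom G (g, h)) _).symm).trans ?_
      exact Finset.sum_congr rfl fun x _ => h3 g h x y z
    · refine ((Equiv.sum_comp (Equiv.inv G) _).symm).trans ?_
      exact Finset.sum_congr rfl fun x _ => h4 x y z⟩
  map_add' f k := by ext; simp [Finset.sum_add_distrib]
  map_smul' c f := by ext; simp [Finset.mul_sum]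

theorem marginal_surjective [Fintype G] : Function.Surjective (marginal G) := by
  rintro ⟨b, h1, h3, h4⟩
  have hN : (Fintype.card G : ℂ) ≠ 0 := by exact_mod_cast Fintype.card_ne_zero
  set β := ∑ x, b (x, 1) with hβ
  have hsum : ∀ y, ∑ x, b (x, y) = β := fun y => by
    rw [hβ, ← Equiv.sum_comp (Equiv.mulRight y)]
    refine Finset.sum_congr rfl fun x _ => ?_
    simpa using h3 1 y⁻¹ x 1
  refine ⟨⟨fun p => (Fintype.card G : ℂ)⁻¹ * (b (p.1, p.2.1) + b (p.1, p.2.2) + b (p.2.1, p.2.2)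
    - 2 * (Fintype.card G : ℂ)⁻¹ * β), ?_, ?_, ?_, ?_⟩, ?_⟩
  · intro x y z
    simp only [h1 x y]
    ring
  · intro x y z
    simp only [h1 y z]
    ring
  · intro g h x y z
    simp only [h3]
  · intro x y z
    simp only [h4]
  · refine Subtype.ext (funext fun p => ?_)
    obtain ⟨y, z⟩ := p
    change ∑ x, (Fintype.card G : ℂ)⁻¹ * (b (x, y) + b (x, z) + b (y, z)
      - 2 * (Fintype.card G : ℂ)⁻¹ * β) = b (y, z)
    rw [← Finset.mul_sum, Finset.sum_sub_distrib, Finset.sum_add_distrib, Finset.sum_add_distrib,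
      hsum, hsum]
    simp only [Finset.sum_const, Finset.card_univ, nsmul_eq_mul]
    field_simp
    ring

theorem dimAThetaOddKerAug_eq_finrank_ker [Fintype G] :
    dimAThetaOddKerAug G = Module.finrank ℂ (LinearMap.ker (marginal G)) := by
  rw [LinearEquiv.finrank_eq (Submodule.equivMapOfInjective (thetaInvariants G).subtype
    (thetaInvariants G).injective_subtype (LinearMap.ker (marginal G))), dimAThetaOddKerAug,
    ← Submodule.span_eq ((LinearMap.ker (marginal G)).map (thetaInvariants G).subtype)]
  refine congrArg (fun s : Set (G × G × G → ℂ) => Module.finrank ℂ (Submodule.span ℂ s)) ?_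
  ext f
  simp only [finsum_eq_sum_of_fintype, Set.mem_ofPred_eq, SetLike.mem_coe, Submodule.mem_map,
    LinearMap.mem_ker]
  constructor
  · rintro ⟨h1, h2, h3, h4, h5, -, -⟩
    exact ⟨⟨f, h1, h2, h3, h4⟩, Subtype.ext (funext fun p => h5 p.1 p.2), rfl⟩
  · rintro ⟨⟨f, h1, h2, h3, h4⟩, h, rfl⟩
    have h5 : ∀ y z, ∑ x, f (x, y, z) = 0 := fun y z => congrFun (congrArg Subtype.val h) (y, z)
    refine ⟨h1, h2, h3, h4, h5, fun x z => ?_, fun x y => ?_⟩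
    · rw [← h5 x z]
      exact Finset.sum_congr rfl fun y _ => h1 _ _ _
    · rw [← h5 x y]
      exact Finset.sum_congr rfl fun z _ => (h2 _ _ _).trans (h1 _ _ _)

theorem finrank_pairInvariants_add_dimAThetaOddKerAug [Fintype G] :
    Module.finrank ℂ (pairInvariants G) + dimAThetaOddKerAug G = dimAThetaOddGroupAlgebra G := by
  rw [dimAThetaOddKerAug_eq_finrank_ker, dimAThetaOddGroupAlgebra_eq_finrank,
    ← LinearMap.finrank_range_add_finrank_ker (marginal G),
    LinearMap.range_eq_top.2 marginal_surjective, finrank_top]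

end Dimension

section Products

variable (G H : Type*) [Group G] [Group H]

/-- Regrouping of triples in a product. -/
def tripleProdEquiv (α β : Type*) :
    (α × β) × (α × β) × (α × β) ≃ (α × α × α) × (β × β × β) where
  toFun p := ((p.1.1, p.2.1.1, p.2.2.1), (p.1.2, p.2.1.2, p.2.2.2))
  invFun q := ((q.1.1, q.2.1), (q.1.2.1, q.2.2.1), (q.1.2.2, q.2.2.2))
  left_inv _ := rfl
  right_inv _ := rfl

theorem commutingTriples_prod :
    commutingTriples (G × H) = commutingTriples G * commutingTriples H :=
  Nat.card_subtype_of_equiv_prod (tripleProdEquiv G H) fun a b => by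
    simp [tripleProdEquiv, and_and_and_comm]

theorem reversingTriples_prod :
    reversingTriples (G × H) = reversingTriples G * reversingTriples H :=
  Nat.card_subtype_of_equiv_prod (tripleProdEquiv G H) fun a b => by
    simp [tripleProdEquiv, and_and_and_comm]

theorem squareCommuting_prod :
    squareCommuting (G × H) = squareCommuting G * squareCommuting H :=
  Nat.card_subtype_of_equiv_prod (Equiv.prodProdProdComm G H G H) fun a b => by simp

theorem equalCubes_prod : equalCubes (G × H) = equalCubes G * equalCubes H :=
  Nat.card_subtype_of_equiv_prod (Equiv.prodProdProdComm G H G H) fun a b => by simp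

theorem braidPairs_prod : braidPairs (G × H) = braidPairs G * braidPairs H :=
  Nat.card_subtype_of_equiv_prod (Equiv.prodProdProdComm G H G H) fun a b => by simp

theorem commutingPairs_prod : commutingPairs (G × H) = commutingPairs G * commutingPairs H :=
  Nat.card_subtype_of_equiv_prod (Equiv.prodProdProdComm G H G H) fun a b => by simp

theorem equalSquares_prod : equalSquares (G × H) = equalSquares G * equalSquares H :=
  Nat.card_subtype_of_equiv_prod (Equiv.prodProdProdComm G H G H) fun a b => by simp

theorem reversingPairs_prod : reversingPairs (G × H) = reversingPairs G * reversingPairs H :=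
  Nat.card_subtype_of_equiv_prod (Equiv.prodProdProdComm G H G H) fun a b => by simp

end Products

section Commutative

theorem card_pairs_eq_card_of_iff_snd_eq {C : Type*} {f : C → C} {P : C × C → Prop}
    (h : ∀ k c, P (k, c) ↔ c = f k) : Nat.card {p // P p} = Nat.card C :=
  Nat.card_congr
    { toFun p := p.1.1
      invFun k := ⟨(k, f k), (h _ _).2 rfl⟩
      left_inv p := Subtype.ext (Prod.ext rfl ((h _ _).1 p.2).symm)
      right_inv _ := rfl }

variable (C : Type*) [CommGroup C]

theorem commutingTriples_of_comm : commutingTriples C = Nat.card C ^ 3 := by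
  rw [commutingTriples, Nat.card_congr (Equiv.subtypeUnivEquiv fun p : C × C × C =>
    ⟨mul_comm p.1 p.2.1, mul_comm p.1 p.2.2⟩), Nat.card_prod, Nat.card_prod]
  ring

theorem squareCommuting_of_comm : squareCommuting C = Nat.card C ^ 2 := by
  rw [squareCommuting, Nat.card_congr (Equiv.subtypeUnivEquiv fun p : C × C =>
    mul_comm (p.1 * p.1) p.2), Nat.card_prod, sq]

theorem commutingPairs_of_comm : commutingPairs C = Nat.card C ^ 2 := by
  rw [commutingPairs, Nat.card_congr (Equiv.subtypeUnivEquiv fun p : C × C =>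
    mul_comm p.1 p.2), Nat.card_prod, sq]

variable {C}

theorem equalCubes_of_comm (h3 : (Nat.card C).Coprime 3) : equalCubes C = Nat.card C :=
  card_pairs_eq_card_of_iff_snd_eq (f := id) fun k c => by
    have := (powCoprime h3).injective.eq_iff (a := k) (b := c)
    simpa [pow_succ, eq_comm] using this

theorem equalSquares_of_comm (h2 : (Nat.card C).Coprime 2) : equalSquares C = Nat.card C :=
  card_pairs_eq_card_of_iff_snd_eq (f := id) fun k c => by
    have := (powCoprime h2).injective.eq_iff (a := k) (b := c)
    simpa [pow_succ, eq_comm] using this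

theorem braidPairs_of_comm : braidPairs C = Nat.card C :=
  card_pairs_eq_card_of_iff_snd_eq (f := fun _ => 1) fun k c => by
    simp [mul_comm k c, ← mul_assoc]

theorem mul_mul_self_eq_iff (h2 : (Nat.card C).Coprime 2) (k c : C) : c * k * c = k ↔ c = 1 := by
  have := (powCoprime h2).injective.eq_iff (a := c) (b := 1)
  simpa [sq, mul_right_comm c k c] using this

theorem reversingPairs_of_comm (h2 : (Nat.card C).Coprime 2) : reversingPairs C = Nat.card C :=
  card_pairs_eq_card_of_iff_snd_eq (f := fun _ => 1) fun k c => mul_mul_self_eq_iff h2 k c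

theorem reversingTriples_of_comm (h2 : (Nat.card C).Coprime 2) :
    reversingTriples C = Nat.card C :=
  Nat.card_congr
    { toFun p := p.1.1
      invFun k := ⟨(k, 1, 1), by simp⟩
      left_inv p := by
        obtain ⟨⟨k, c, d⟩, hc, hd⟩ := p
        obtain rfl := (mul_mul_self_eq_iff h2 _ _).1 hc
        obtain rfl := (mul_mul_self_eq_iff h2 _ _).1 hd
        rfl
      right_inv _ := rfl }

end Commutative

section BinaryIcosahedral

/-- The entries of a `2 × 2` matrix over `ℤ/5`, row by row. -/
abbrev Quad : Type := ZMod 5 × ZMod 5 × ZMod 5 × ZMod 5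

namespace Quad

/-- Matrix multiplication. -/
def mul (p q : Quad) : Quad :=
  (p.1 * q.1 + p.2.1 * q.2.2.1, p.1 * q.2.1 + p.2.1 * q.2.2.2,
    p.2.2.1 * q.1 + p.2.2.2 * q.2.2.1, p.2.2.1 * q.2.1 + p.2.2.2 * q.2.2.2)

/-- The determinant. -/
def det (p : Quad) : ZMod 5 := p.1 * p.2.2.2 - p.2.1 * p.2.2.1

/-- The matrices of determinant one. -/
def unimodular : Finset Quad := Finset.univ.filter fun q => q.det = 1

/-- The lower left entry of the representative of a noncentral
conjugacy class: it is determined up to squares when the trace is `± 2`. -/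
def classInvariant (q : Quad) : ZMod 5 :=
  if q.1 + q.2.2.2 = 2 ∨ q.1 + q.2.2.2 = -2 then
    if (if q.2.2.1 = 0 then q.2.1 else q.2.2.1) ^ 2 = 1 then 1 else 2
  else 1

/-- A representative of the conjugacy class. -/
def rep (q : Quad) : Quad :=
  if q.2.1 = 0 ∧ q.2.2.1 = 0 ∧ q.1 = q.2.2.2 then q
  else (0, -(q.classInvariant) ^ 3, q.classInvariant, q.1 + q.2.2.2)

/-- A matrix with first column `(x, y)` conjugating a noncentral matrix to its representative. -/
def conjugator (q : Quad) (x y : ZMod 5) : Quad :=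
  (x, q.classInvariant ^ 3 * (q.1 * x + q.2.1 * y), y,
    q.classInvariant ^ 3 * (q.2.2.1 * x + q.2.2.2 * y))

theorem rep_mem_unimodular : ∀ q ∈ unimodular, q.rep ∈ unimodular := by
  decide +kernel

theorem rep_conj : ∀ q ∈ unimodular, q.rep = q ∨ ∃ x y, q.conjugator x y ∈ unimodular ∧
    (q.conjugator x y).mul q.rep = q.mul (q.conjugator x y) := by
  decide +kernel

end Quad

/-- The entries of an element of the binary icosahedral group. -/
def toQuad (g : binaryIcosahedralGroup) : Quad := (g.1 0 0, g.1 0 1, g.1 1 0, g.1 1 1)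

theorem toQuad_mul (g h : binaryIcosahedralGroup) :
    toQuad (g * h) = (toQuad g).mul (toQuad h) := by
  simp [toQuad, Quad.mul, Matrix.mul_apply, Fin.sum_univ_two]

theorem toQuad_injective : Function.Injective toQuad := by
  intro g h hgh
  simp only [toQuad, Prod.mk.injEq] at hgh
  refine Subtype.ext (Matrix.ext fun i j => ?_)
  fin_cases i <;> fin_cases j <;> simp [hgh]

theorem toQuad_inj {g h : binaryIcosahedralGroup} : toQuad g = toQuad h ↔ g = h :=
  toQuad_injective.eq_iff

theorem mem_unimodular {q : Quad} : q ∈ Quad.unimodular ↔ ∃ g, toQuad g = q := by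
  simp only [Quad.unimodular, Finset.mem_filter, Finset.mem_univ, true_and]
  constructor
  · intro h
    exact ⟨⟨!![q.1, q.2.1; q.2.2.1, q.2.2.2], by rwa [Matrix.det_fin_two_of]⟩, rfl⟩
  · rintro ⟨g, rfl⟩
    rw [← g.2, Matrix.det_fin_two]
    rfl

theorem card_subtype_toQuad (R : Quad → Prop) [DecidablePred R] :
    Nat.card {c // R (toQuad c)} = (Quad.unimodular.filter R).card := by
  rw [← Nat.card_eq_finsetCard]
  refine Nat.card_congr (Equiv.ofBijective (fun c => ⟨toQuad c.1,
    Finset.mem_filter.2 ⟨mem_unimodular.2 ⟨_, rfl⟩, c.2⟩⟩) ⟨fun c d h => ?_, fun q => ?_⟩)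
  · exact Subtype.ext (toQuad_injective (congrArg Subtype.val h))
  · obtain ⟨q, hq⟩ := q
    obtain ⟨hu, hq⟩ := Finset.mem_filter.1 hq
    obtain ⟨g, rfl⟩ := mem_unimodular.1 hu
    exact ⟨⟨g, hq⟩, rfl⟩

theorem sum_eq_sum_unimodular [Fintype binaryIcosahedralGroup] (ψ : Quad → ℕ) :
    ∑ g, ψ (toQuad g) = ∑ q ∈ Quad.unimodular, ψ q := by
  refine Finset.sum_bij (fun g _ => toQuad g) (fun g _ => mem_unimodular.2 ⟨g, rfl⟩)
    (fun _ _ _ _ h => toQuad_injective h) (fun q hq => ?_) fun _ _ => rfl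
  obtain ⟨g, rfl⟩ := mem_unimodular.1 hq
  exact ⟨g, Finset.mem_univ _, rfl⟩

/-- Summation over the binary icosahedral group of a class function through representatives. -/
theorem sum_card_eq_sum_rep [Fintype binaryIcosahedralGroup]
    (P : binaryIcosahedralGroup → binaryIcosahedralGroup → Prop)
    (R : Quad → Quad → Prop) [∀ q, DecidablePred (R q)]
    (hR : ∀ g c, P g c ↔ R (toQuad g) (toQuad c))
    (hP : ∀ (α : binaryIcosahedralGroup ≃* binaryIcosahedralGroup) g c, P g c → P (α g) (α c))
    (F : ℕ → ℕ) :
    ∑ g, F (Nat.card {c // P g c}) =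
      ∑ r ∈ Quad.unimodular.image Quad.rep, (Quad.unimodular.filter fun q => q.rep = r).card *
        F (Quad.unimodular.filter (R r)).card := by
  have hcard : ∀ g, Nat.card {c // P g c} = (Quad.unimodular.filter (R (toQuad g))).card :=
    fun g => by simp only [hR, card_subtype_toQuad]
  have hconj : ∀ g h, Nat.card {c // P (h * g * h⁻¹) c} = Nat.card {c // P g c} := fun g h =>
    (Nat.card_congr ((MulAut.conj h).toEquiv.subtypeEquiv fun c => ⟨hP (MulAut.conj h) g c,
      fun hc => by simpa [mul_assoc] using hP (MulAut.conj h⁻¹) _ _ hc⟩)).symm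
  simp only [hcard]
  rw [sum_eq_sum_unimodular fun q => F (Quad.unimodular.filter (R q)).card]
  simp only [← smul_eq_mul]
  rw [← Finset.sum_comp (fun r => F (Quad.unimodular.filter (R r)).card)]
  refine Finset.sum_congr rfl fun q hq => congrArg F ?_
  rcases Quad.rep_conj q hq with h | ⟨x, y, hu, h⟩
  · rw [h]
  · obtain ⟨k, hk⟩ := mem_unimodular.1 hu
    obtain ⟨g, rfl⟩ := mem_unimodular.1 hq
    obtain ⟨r, hr⟩ := mem_unimodular.1 (Quad.rep_mem_unimodular _ hq)
    rw [← hk, ← hr, ← toQuad_mul, ← toQuad_mul, toQuad_inj] at h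
    rw [← hr, ← hcard, ← hcard, ← hconj r k, h, mul_inv_cancel_right]

end BinaryIcosahedral

section Icosahedral

theorem card_pairs_eq_sum {G : Type*} [Fintype G] (P : G → G → Prop) :
    Nat.card {p : G × G // P p.1 p.2} = ∑ g, Nat.card {c // P g c} := by
  rw [← Nat.card_sigma]
  exact Nat.card_congr
    { toFun p := ⟨p.1.1, p.1.2, p.2⟩
      invFun p := ⟨(p.1, p.2.1), p.2.2⟩
      left_inv _ := rfl
      right_inv _ := rfl }

theorem card_triples_eq_sum {G : Type*} [Fintype G] (P : G → G → Prop) :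
    Nat.card {p : G × G × G // P p.1 p.2.1 ∧ P p.1 p.2.2} = ∑ g, Nat.card {c // P g c} ^ 2 := by
  simp_rw [sq, ← Nat.card_prod]
  rw [← Nat.card_sigma]
  exact Nat.card_congr
    { toFun p := ⟨p.1.1, ⟨p.1.2.1, p.2.1⟩, ⟨p.1.2.2, p.2.2⟩⟩
      invFun p := ⟨(p.1, p.2.1, p.2.2), p.2.1.2, p.2.2.2⟩
      left_inv _ := rfl
      right_inv _ := rfl }

theorem card_binaryIcosahedralGroup : Nat.card binaryIcosahedralGroup = 120 := by
  rw [← Nat.card_congr (Equiv.subtypeUnivEquiv fun _ : binaryIcosahedralGroup => trivial),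
    card_subtype_toQuad fun _ => True]
  decide +kernel

theorem commutingTriples_binaryIcosahedralGroup :
    commutingTriples binaryIcosahedralGroup = 35520 := by
  have := Fintype.ofFinite binaryIcosahedralGroup
  refine (card_triples_eq_sum fun g c : binaryIcosahedralGroup => g * c = c * g).trans
    ((sum_card_eq_sum_rep _ (fun p q => p.mul q = q.mul p)
    (fun g c => by simp only [← toQuad_mul, toQuad_inj])
    (fun α g c h => by simpa only [map_mul] using congrArg α h) (· ^ 2)).trans ?_)
  decide +kernel

theorem reversingTriples_binaryIcosahedralGroup :
    reversingTriples binaryIcosahedralGroup = 27360 := by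
  have := Fintype.ofFinite binaryIcosahedralGroup
  refine (card_triples_eq_sum fun g c : binaryIcosahedralGroup => c * g * c = g).trans
    ((sum_card_eq_sum_rep _ (fun p q => (q.mul p).mul q = p)
    (fun g c => by simp only [← toQuad_mul, toQuad_inj])
    (fun α g c h => by simpa only [map_mul] using congrArg α h) (· ^ 2)).trans ?_)
  decide +kernel

theorem squareCommuting_binaryIcosahedralGroup :
    squareCommuting binaryIcosahedralGroup = 4560 := by
  have := Fintype.ofFinite binaryIcosahedralGroup
  refine (card_pairs_eq_sum fun g c : binaryIcosahedralGroup => g * g * c = c * (g * g)).trans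
    ((sum_card_eq_sum_rep _ (fun p q => (p.mul p).mul q = q.mul (p.mul p))
    (fun g c => by simp only [← toQuad_mul, toQuad_inj])
    (fun α g c h => by simpa only [map_mul] using congrArg α h) id).trans ?_)
  decide +kernel

theorem equalCubes_binaryIcosahedralGroup : equalCubes binaryIcosahedralGroup = 960 := by
  have := Fintype.ofFinite binaryIcosahedralGroup
  refine (card_pairs_eq_sum fun g c : binaryIcosahedralGroup => g * g * g = c * c * c).trans
    ((sum_card_eq_sum_rep _ (fun p q => (p.mul p).mul p = (q.mul q).mul q)
    (fun g c => by simp only [← toQuad_mul, toQuad_inj])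
    (fun α g c h => by simpa only [map_mul] using congrArg α h) id).trans ?_)
  decide +kernel

theorem braidPairs_binaryIcosahedralGroup : braidPairs binaryIcosahedralGroup = 720 := by
  have := Fintype.ofFinite binaryIcosahedralGroup
  refine (card_pairs_eq_sum fun g c : binaryIcosahedralGroup => c * (g * g) * c = g * c * g).trans
    ((sum_card_eq_sum_rep _ (fun p q => (q.mul (p.mul p)).mul q = (p.mul q).mul p)
    (fun g c => by simp only [← toQuad_mul, toQuad_inj])
    (fun α g c h => by simpa only [map_mul] using congrArg α h) id).trans ?_)
  decide +kernel

theorem commutingPairs_binaryIcosahedralGroup :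
    commutingPairs binaryIcosahedralGroup = 1080 := by
  have := Fintype.ofFinite binaryIcosahedralGroup
  refine (card_pairs_eq_sum fun g c : binaryIcosahedralGroup => g * c = c * g).trans
    ((sum_card_eq_sum_rep _ (fun p q => p.mul q = q.mul p)
    (fun g c => by simp only [← toQuad_mul, toQuad_inj])
    (fun α g c h => by simpa only [map_mul] using congrArg α h) id).trans ?_)
  decide +kernel

theorem equalSquares_binaryIcosahedralGroup : equalSquares binaryIcosahedralGroup = 1080 := by
  have := Fintype.ofFinite binaryIcosahedralGroup
  refine (card_pairs_eq_sum fun g c : binaryIcosahedralGroup => g * g = c * c).trans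
    ((sum_card_eq_sum_rep _ (fun p q => p.mul p = q.mul q)
    (fun g c => by simp only [← toQuad_mul, toQuad_inj])
    (fun α g c h => by simpa only [map_mul] using congrArg α h) id).trans ?_)
  decide +kernel

theorem reversingPairs_binaryIcosahedralGroup :
    reversingPairs binaryIcosahedralGroup = 1080 := by
  have := Fintype.ofFinite binaryIcosahedralGroup
  refine (card_pairs_eq_sum fun g c : binaryIcosahedralGroup => c * g * c = g).trans
    ((sum_card_eq_sum_rep _ (fun p q => (q.mul p).mul q = p)
    (fun g c => by simp only [← toQuad_mul, toQuad_inj])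
    (fun α g c h => by simpa only [map_mul] using congrArg α h) id).trans ?_)
  decide +kernel

theorem finrank_pairInvariants_prod_binaryIcosahedralGroup (C : Type*) [CommGroup C] [Finite C]
    (h2 : (Nat.card C).Coprime 2) :
    480 * Module.finrank ℂ (pairInvariants (C × binaryIcosahedralGroup)) =
      2160 * Nat.card C + 2160 := by
  have := Fintype.ofFinite (C × binaryIcosahedralGroup)
  have key := finrank_pairInvariants (G := C × binaryIcosahedralGroup)
  rw [← Nat.card_eq_fintype_card, Nat.card_prod, card_binaryIcosahedralGroup,
    commutingPairs_prod, equalSquares_prod, reversingPairs_prod, commutingPairs_of_comm,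
    equalSquares_of_comm h2, reversingPairs_of_comm h2, commutingPairs_binaryIcosahedralGroup,
    equalSquares_binaryIcosahedralGroup, reversingPairs_binaryIcosahedralGroup] at key
  refine Nat.eq_of_mul_eq_mul_left (Nat.card_pos (α := C)) ?_
  linear_combination key

theorem dimAThetaOddGroupAlgebra_prod_binaryIcosahedralGroup (C : Type*) [CommGroup C] [Finite C]
    (h2 : (Nat.card C).Coprime 2) (h3 : (Nat.card C).Coprime 3) :
    1440 * dimAThetaOddGroupAlgebra (C × binaryIcosahedralGroup) =
      35520 * Nat.card C ^ 2 + 27360 * Nat.card C + 30720 := by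
  have := Fintype.ofFinite (C × binaryIcosahedralGroup)
  have key := finrank_thetaInvariants (G := C × binaryIcosahedralGroup)
  rw [← Nat.card_eq_fintype_card, Nat.card_prod, card_binaryIcosahedralGroup,
    commutingTriples_prod, squareCommuting_prod, equalCubes_prod, reversingTriples_prod,
    braidPairs_prod, commutingTriples_of_comm, squareCommuting_of_comm, equalCubes_of_comm h3,
    reversingTriples_of_comm h2, braidPairs_of_comm, commutingTriples_binaryIcosahedralGroup,
    squareCommuting_binaryIcosahedralGroup, equalCubes_binaryIcosahedralGroup,
    reversingTriples_binaryIcosahedralGroup, braidPairs_binaryIcosahedralGroup,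
    ← dimAThetaOddGroupAlgebra_eq_finrank] at key
  refine Nat.eq_of_mul_eq_mul_left (Nat.card_pos (α := C)) ?_
  linear_combination key

theorem finrank_pairInvariants_binaryIcosahedralGroup :
    Module.finrank ℂ (pairInvariants binaryIcosahedralGroup) = 9 := by
  have := Fintype.ofFinite binaryIcosahedralGroup
  have key := finrank_pairInvariants (G := binaryIcosahedralGroup)
  rw [← Nat.card_eq_fintype_card, card_binaryIcosahedralGroup,
    commutingPairs_binaryIcosahedralGroup, equalSquares_binaryIcosahedralGroup,
    reversingPairs_binaryIcosahedralGroup] at key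
  lia

theorem dimAThetaOddGroupAlgebra_binaryIcosahedralGroup :
    dimAThetaOddGroupAlgebra binaryIcosahedralGroup = 65 := by
  have := Fintype.ofFinite binaryIcosahedralGroup
  have key := finrank_thetaInvariants (G := binaryIcosahedralGroup)
  rw [← Nat.card_eq_fintype_card, card_binaryIcosahedralGroup,
    commutingTriples_binaryIcosahedralGroup, squareCommuting_binaryIcosahedralGroup,
    equalCubes_binaryIcosahedralGroup, reversingTriples_binaryIcosahedralGroup,
    braidPairs_binaryIcosahedralGroup, ← dimAThetaOddGroupAlgebra_eq_finrank] at key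
  lia

end Icosahedral

/-- the dimension formulas for `π = (ℤ/mℤ) × I*`, `gcd(m, 30) = 1`; in
particular the values `65` and `56` for `π = I*` itself. -/
theorem dim_aThetaOdd_zmod_prod_binaryIcosahedral (m : ℕ) (hm : 1 ≤ m)
    (hcop : Nat.gcd m 30 = 1) :
    (dimAThetaOddGroupAlgebra (Multiplicative (ZMod m) × binaryIcosahedralGroup) : ℚ)
      = (74/3) * m^2 + 19 * m + 64/3 ∧
    (dimAThetaOddKerAug (Multiplicative (ZMod m) × binaryIcosahedralGroup) : ℚ)
      = (74/3) * m^2 + (29/2) * m + 101/6 ∧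
    dimAThetaOddGroupAlgebra binaryIcosahedralGroup = 65 ∧
    dimAThetaOddKerAug binaryIcosahedralGroup = 56 := by
  have : NeZero m := ⟨by lia⟩
  have hm2 : m.Coprime 2 := Nat.Coprime.coprime_dvd_right (by norm_num) hcop
  have hm3 : m.Coprime 3 := Nat.Coprime.coprime_dvd_right (by norm_num) hcop
  have hcard : Nat.card (Multiplicative (ZMod m)) = m := Nat.card_zmod m
  have : Finite (Multiplicative (ZMod m)) := inferInstanceAs (Finite (ZMod m))
  have := Fintype.ofFinite binaryIcosahedralGroup
  have := Fintype.ofFinite (Multiplicative (ZMod m) × binaryIcosahedralGroup)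
  have hpair := finrank_pairInvariants_prod_binaryIcosahedralGroup (Multiplicative (ZMod m))
    (hcard.symm ▸ hm2)
  have htheta := dimAThetaOddGroupAlgebra_prod_binaryIcosahedralGroup (Multiplicative (ZMod m))
    (hcard.symm ▸ hm2) (hcard.symm ▸ hm3)
  have hker := finrank_pairInvariants_add_dimAThetaOddKerAug
    (G := Multiplicative (ZMod m) × binaryIcosahedralGroup)
  have hker1 := finrank_pairInvariants_add_dimAThetaOddKerAug (G := binaryIcosahedralGroup)
  rw [hcard] at hpair htheta
  rw [finrank_pairInvariants_binaryIcosahedralGroup,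
    dimAThetaOddGroupAlgebra_binaryIcosahedralGroup] at hker1
  qify at hpair htheta hker
  refine ⟨?_, ?_, dimAThetaOddGroupAlgebra_binaryIcosahedralGroup, by lia⟩
  · linear_combination htheta / 1440
  · linear_combination hker + htheta / 1440 - hpair / 480
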